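/- arXiv:2212.12229 — 2 statements merged into one kernel-verified Lean document; each statement's English description precedes it below -/
import Mathlib

section
/- (Bilinear Parseval identity, equation (F-PF) in the proof of Proposition 2.2.) For all v, f ∈ L²(ℝ^d), the family ((v, G^A_{α̃})_{L²} (G^A_{α̃}, f)_{L²})_{α̃∈Γ̃} is absolutely summable and ∑_{α̃∈Γ̃} (v, G^A_{α̃})_{L²} (G^A_{α̃}, f)_{L²} = (v, f)_{L²}. -/
open MeasureTheory Complex
open scoped BigOperators ComplexConjugate ComplexInnerProductSpace

noncomputable section

/-- Euclidean dot product on `ℝ^d` (realized as `Fin d → ℝ`). -/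
def dotR {d : ℕ} (x y : Fin d → ℝ) : ℝ := ∑ i, x i * y i

/-- Japanese bracket `⟨x⟩ = (1+|x|²)^(1/2)` (Euclidean norm). -/
def jap {d : ℕ} (x : Fin d → ℝ) : ℝ := Real.sqrt (1 + dotR x x)

/-- Euclidean norm on `ℝ^d`. -/
def enr {d : ℕ} (x : Fin d → ℝ) : ℝ := Real.sqrt (dotR x x)

/-- Embedding of the lattice `ℤ^d` into `ℝ^d`. -/
def zToR {d : ℕ} (γ : Fin d → ℤ) : Fin d → ℝ := fun i => (γ i : ℝ)

/-- The point `2πk` of the dual lattice `(2πℤ)^d`, for `k ∈ ℤ^d`. -/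
def dualV {d : ℕ} (k : Fin d → ℤ) : Fin d → ℝ := fun i => 2 * Real.pi * (k i : ℝ)

/-- The magnetic phase `Λ^A(x,y) = exp(−i ∫₀¹ ⟨A(x+t(y−x)), y−x⟩ dt)`. -/
def magPhase {d : ℕ} (A : (Fin d → ℝ) → (Fin d → ℝ)) (x y : Fin d → ℝ) : ℂ :=
  Complex.exp (-Complex.I *
    ((∫ t in (0:ℝ)..1, dotR (A (x + t • (y - x))) (y - x)) : ℝ))

/-- The magnetic Gabor frame function
`G^A_{γ,γ*}(x) = Λ^A(x,γ) θ_{γ*}(x−γ) g(x−γ)` with `γ* = 2πk`. -/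
def gaborF {d : ℕ} (A : (Fin d → ℝ) → (Fin d → ℝ)) (g : (Fin d → ℝ) → ℝ)
    (γ k : Fin d → ℤ) (x : Fin d → ℝ) : ℂ :=
  magPhase A x (zToR γ) * (((2 * Real.pi) ^ (-(d : ℝ) / 2) : ℝ) : ℂ) *
    Complex.exp (Complex.I * ((dotR (dualV k) (x - zToR γ) / (2 * Real.pi) : ℝ) : ℂ)) *
    ((g (x - zToR γ) : ℝ) : ℂ)

/-- `g` is a smooth `[0,1]`-valued quadratic partition of unity with support in `(−1,1)^d`. -/
def IsQuadPartition {d : ℕ} (g : (Fin d → ℝ) → ℝ) : Prop :=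
  ContDiff ℝ (⊤ : ℕ∞) g ∧ (∀ x, g x ∈ Set.Icc (0:ℝ) 1) ∧
    tsupport g ⊆ Set.univ.pi (fun _ : Fin d => Set.Ioo (-1:ℝ) 1) ∧
    ∀ x, HasSum (fun γ : Fin d → ℤ => (g (x - zToR γ)) ^ 2) 1

/-- Iterated directional derivative along a list of directions. -/
def dList {E F : Type*} [NormedAddCommGroup E] [NormedSpace ℝ E]
    [NormedAddCommGroup F] [NormedSpace ℝ F] : List E → (E → F) → (E → F)
  | [], f => f
  | v :: L, f => fun x => fderiv ℝ (dList L f) x v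

/-- Direction of differentiation in the first (position) variable. -/
def dirX {d : ℕ} (j : Fin d) : (Fin d → ℝ) × (Fin d → ℝ) := (Pi.single j 1, 0)

/-- Direction of differentiation in the second (momentum) variable. -/
def dirXi {d : ℕ} (j : Fin d) : (Fin d → ℝ) × (Fin d → ℝ) := (0, Pi.single j 1)

/-- The Hörmander class `S^p_0(ℝ^{2d})`. -/
def HormClass (d : ℕ) (p : ℝ) (Φ : ((Fin d → ℝ) × (Fin d → ℝ)) → ℂ) : Prop :=
  ContDiff ℝ (⊤ : ℕ∞) Φ ∧
    ∀ a b : List (Fin d), ∃ C : ℝ,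
      ∀ x ξ : Fin d → ℝ,
        ‖dList (a.map dirX ++ b.map dirXi) Φ (x, ξ)‖ ≤ C * jap ξ ^ p

/-- The magnetic field `B_{jk} = ∂_j A_k − ∂_k A_j` of a vector potential `A`. -/
def Bof {d : ℕ} (A : (Fin d → ℝ) → (Fin d → ℝ)) (j k : Fin d) (x : Fin d → ℝ) : ℝ :=
  fderiv ℝ A x (Pi.single j 1) k - fderiv ℝ A x (Pi.single k 1) j

/-- Each component `B j k` is bounded together with all its partial derivatives. -/
def BBounded {d : ℕ} (B : Fin d → Fin d → (Fin d → ℝ) → ℝ) : Prop :=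
  ∀ j k : Fin d, ∀ L : List (Fin d), ∃ C : ℝ,
    ∀ x, ‖dList (L.map (fun i => Pi.single i (1:ℝ))) (B j k) x‖ ≤ C

/-- Flux of `B` through the triangle with vertices `a, b, c`. -/
def fluxB {d : ℕ} (B : Fin d → Fin d → (Fin d → ℝ) → ℝ) (a b c : Fin d → ℝ) : ℝ :=
  ∫ t in (0:ℝ)..1, ∫ s in (0:ℝ)..1,
    ∑ j, ∑ k, B j k (a + t • (b - a) + (s * t) • (c - b)) *
      ((b - a) j + s * (c - b) j) * (t * (c - b) k)

/-- `Ω^B(a,b,c) = exp(−i ∫_{⟨a,b,c⟩} B)`. -/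
def OmegaB {d : ℕ} (B : Fin d → Fin d → (Fin d → ℝ) → ℝ) (a b c : Fin d → ℝ) : ℂ :=
  Complex.exp (-Complex.I * (fluxB B a b c : ℝ))

section FourierCube

attribute [local instance] instMeasureSpaceUnitAddCircle

/-- **Parseval's identity** for Fourier coefficients on a unit cube of `ℝ^d`. -/
theorem hasSum_sq_integral_exp_unit_cube {d : ℕ} (a : Fin d → ℝ) (H : (Fin d → ℝ) → ℂ)
    (hH : MemLp H 2 (volume.restrict {x | ∀ i, x i ∈ Set.Ioc (a i) (a i + 1)})) :
    HasSum (fun k : Fin d → ℤ =>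
      ‖∫ x in {x : Fin d → ℝ | ∀ i, x i ∈ Set.Ioc (a i) (a i + 1)},
        Complex.exp (-Complex.I * (dotR (dualV k) x : ℝ)) * H x‖ ^ 2)
      (∫ x in {x : Fin d → ℝ | ∀ i, x i ∈ Set.Ioc (a i) (a i + 1)}, ‖H x‖ ^ 2) := by
  have hQ : MeasurableSet {x : Fin d → ℝ | ∀ i, x i ∈ Set.Ioc (a i) (a i + 1)} := by
    rw [Set.ofPred_forall]
    exact MeasurableSet.iInter fun i => measurableSet_Ioc.preimage (measurable_pi_apply i)
  have he := (MeasurePreserving.mk measurable_subtype_coe (map_comap_subtype_coe hQ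
    (volume : Measure (Fin d → ℝ)))).comp (UnitAddTorus.measurePreserving_equivPiIoc a)
  set F : UnitAddTorus (Fin d) → ℂ := H ∘ Subtype.val ∘ UnitAddTorus.measurableEquivPiIoc a
    with hF
  have hFL : MemLp F 2 volume := hH.comp_measurePreserving he
  have hFx : ∀ x ∈ {x : Fin d → ℝ | ∀ i, x i ∈ Set.Ioc (a i) (a i + 1)},
      F (fun i => (x i : UnitAddCircle)) = H x := by
    intro x hx
    simp only [hF, Function.comp_apply]
    rw [← UnitAddTorus.coe_symm_measurableEquivPiIoc_apply a ⟨x, hx⟩,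
      MeasurableEquiv.apply_symm_apply]
  have key := UnitAddTorus.hasSum_sq_mFourierCoeff (hFL.toLp F)
  have h1 : ∫ t, ‖hFL.toLp F t‖ ^ 2 =
      ∫ x in {x : Fin d → ℝ | ∀ i, x i ∈ Set.Ioc (a i) (a i + 1)}, ‖H x‖ ^ 2 := by
    rw [integral_congr_ae (g := fun t => ‖F t‖ ^ 2)
      (hFL.coeFn_toLp.mono fun t ht => by simp only [ht]),
      UnitAddTorus.integral_preimage _ a]
    exact setIntegral_congr_fun hQ fun x hx => by simp only [hFx x hx]
  have h2 : ∀ k : Fin d → ℤ, UnitAddTorus.mFourierCoeff (hFL.toLp F) k =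
      ∫ x in {x : Fin d → ℝ | ∀ i, x i ∈ Set.Ioc (a i) (a i + 1)},
        Complex.exp (-Complex.I * (dotR (dualV k) x : ℝ)) * H x := by
    intro k
    have : UnitAddTorus.mFourierCoeff (hFL.toLp F) k = UnitAddTorus.mFourierCoeff F k :=
      integral_congr_ae (hFL.coeFn_toLp.mono fun t ht => by simp only [ht])
    rw [this, UnitAddTorus.mFourierCoeff_eq_integral _ _ a]
    refine setIntegral_congr_fun hQ fun x hx => ?_
    simp only [hFx x hx, smul_eq_mul]
    congr 1
    simp only [UnitAddTorus.mFourier, ContinuousMap.coe_mk, fourier_coe_apply, ← Complex.exp_sum,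
      dotR, dualV, Pi.neg_apply]
    congr 1
    push_cast
    rw [Finset.mul_sum]
    exact Finset.sum_congr rfl fun i _ => by ring
  simp only [← h1, ← h2]
  exact key

end FourierCube

/-- **Parseval's identity** for the system `(2π)^{-d/2} exp(i⟨k, ·⟩)` and functions supported
in `(-1, 1)^d`. -/
theorem hasSum_sq_integral_exp_of_support {d : ℕ} (h : (Fin d → ℝ) → ℂ) (hh : MemLp h 2 volume)
    (hsupp : ∀ y, h y ≠ 0 → ∀ i, y i ∈ Set.Ioo (-1 : ℝ) 1) :
    HasSum (fun k : Fin d → ℤ =>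
      ‖∫ y, (((2 * Real.pi) ^ (-(d : ℝ) / 2) : ℝ) : ℂ) *
        Complex.exp (-Complex.I * (dotR (dualV k) y / (2 * Real.pi) : ℝ)) * h y‖ ^ 2)
      (∫ y, ‖h y‖ ^ 2) := by
  have hpi : 0 < 2 * Real.pi := by positivity
  set c : ℝ := (2 * Real.pi) ^ (-(d : ℝ) / 2) with hc
  have hc0 : 0 < c := by positivity
  have hc2 : c ^ 2 = ((2 * Real.pi) ^ d)⁻¹ := by
    rw [hc, ← Real.rpow_natCast, ← Real.rpow_mul hpi.le, ← Real.rpow_natCast,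
      ← Real.rpow_neg hpi.le]
    congr 1
    push_cast
    ring
  set Q : Set (Fin d → ℝ) := {x | ∀ i, x i ∈ Set.Ioc (-(1 / 2) : ℝ) (-(1 / 2) + 1)} with hQ
  set H : (Fin d → ℝ) → ℂ := fun t => (c⁻¹ : ℝ) * h ((2 * Real.pi) • t) with hH
  have hHQ : ∀ t, t ∉ Q → H t = 0 := by
    intro t ht
    by_contra hne
    refine ht fun i => ?_
    have hi := hsupp _ (right_ne_zero_of_mul hne) i
    simp only [Pi.smul_apply, smul_eq_mul, Set.mem_Ioo] at hi
    have := Real.pi_gt_three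
    constructor <;> nlinarith
  have hscale : ∀ {E : Type} [NormedAddCommGroup E] [NormedSpace ℝ E] (φ : (Fin d → ℝ) → E),
      ∫ t, φ ((2 * Real.pi) • t) = (c ^ 2) • ∫ y, φ y := by
    intro E _ _ φ
    rw [Measure.integral_comp_smul, hc2, Module.finrank_fin_fun, abs_of_pos (by positivity)]
  have hHL : MemLp H 2 volume := by
    have hsm : AEStronglyMeasurable H volume := by
      refine AEStronglyMeasurable.const_mul ?_ _
      exact hh.1.comp_quasiMeasurePreserving
        (Measure.quasiMeasurePreserving_smul _ hpi.ne')
    rw [memLp_two_iff_integrable_sq_norm hsm]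
    have := (memLp_two_iff_integrable_sq_norm hh.1).1 hh
    simp only [hH, norm_mul, mul_pow]
    exact (this.comp_smul hpi.ne').const_mul _
  have key := hasSum_sq_integral_exp_unit_cube (fun _ : Fin d => (-(1 / 2) : ℝ)) H (hHL.restrict _)
  have h1 : ∫ x in Q, ‖H x‖ ^ 2 = ∫ y, ‖h y‖ ^ 2 := by
    rw [setIntegral_eq_integral_of_forall_compl_eq_zero (fun t ht => by simp [hHQ t ht])]
    simp only [hH, norm_mul, mul_pow]
    rw [hscale fun y => ‖((c⁻¹ : ℝ) : ℂ)‖ ^ 2 * ‖h y‖ ^ 2, integral_const_mul]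
    simp only [Complex.norm_real, norm_inv, Real.norm_of_nonneg hc0.le, smul_eq_mul]
    field_simp
  have h2 : ∀ k : Fin d → ℤ,
      ∫ x in Q, Complex.exp (-Complex.I * (dotR (dualV k) x : ℝ)) * H x =
        ∫ y, (c : ℂ) *
          Complex.exp (-Complex.I * (dotR (dualV k) y / (2 * Real.pi) : ℝ)) * h y := by
    intro k
    rw [setIntegral_eq_integral_of_forall_compl_eq_zero (fun t ht => by simp [hHQ t ht])]
    have hdot : ∀ t : Fin d → ℝ,
        dotR (dualV k) t = dotR (dualV k) ((2 * Real.pi) • t) / (2 * Real.pi) := by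
      intro t
      simp only [dotR, Pi.smul_apply, smul_eq_mul, Finset.sum_div]
      exact Finset.sum_congr rfl fun i _ => by field_simp
    simp only [hH]
    rw [integral_congr_ae (Filter.Eventually.of_forall fun t => by rw [hdot t]),
      hscale fun y => Complex.exp (-Complex.I * (dotR (dualV k) y / (2 * Real.pi) : ℝ)) *
        ((c⁻¹ : ℝ) * h y), ← integral_smul]
    refine integral_congr_ae (Filter.Eventually.of_forall fun y => ?_)
    have : (c : ℂ) ≠ 0 := by exact_mod_cast hc0.ne'
    simp only [Complex.real_smul]
    push_cast
    field_simp
  simp only [← h1, ← h2]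
  exact key

theorem norm_magPhase {d : ℕ} (A : (Fin d → ℝ) → (Fin d → ℝ)) (x y : Fin d → ℝ) :
    ‖magPhase A x y‖ = 1 := by
  rw [magPhase, Complex.norm_exp]
  simp

theorem continuous_magPhase_left {d : ℕ} {A : (Fin d → ℝ) → (Fin d → ℝ)} (hA : Continuous A)
    (y : Fin d → ℝ) : Continuous fun x => magPhase A x y := by
  unfold magPhase
  refine Complex.continuous_exp.comp (continuous_const.mul (Complex.continuous_ofReal.comp ?_))
  refine intervalIntegral.continuous_parametric_intervalIntegral_of_continuous' ?_ 0 1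
  unfold Function.uncurry dotR
  fun_prop

/-- Nonnegative families on a product are summed fibrewise. -/
theorem hasSum_prod_of_nonneg {α β : Type*} {F : α × β → ℝ} (hF : ∀ p, 0 ≤ F p) {s : α → ℝ}
    {T : ℝ} (h1 : ∀ a, HasSum (fun b => F (a, b)) (s a)) (h2 : HasSum s T) : HasSum F T := by
  have hsum : Summable F := by
    refine (summable_prod_of_nonneg hF).2 ⟨fun a => (h1 a).summable, ?_⟩
    simpa only [fun a => (h1 a).tsum_eq] using h2.summable
  have := (hsum.hasSum.prod_fiberwise h1).unique h2
  exact this ▸ hsum.hasSum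

/-- Polarization: a family satisfying the quadratic Parseval identity satisfies the bilinear
one, with absolute convergence. -/
theorem hasSum_inner_mul_inner_of_hasSum_norm_sq {ι E : Type*} [NormedAddCommGroup E]
    [InnerProductSpace ℂ E] {G : ι → E} (hG : ∀ f : E, HasSum (fun i => ‖⟪G i, f⟫‖ ^ 2) (‖f‖ ^ 2))
    (v f : E) :
    Summable (fun i => ‖⟪v, G i⟫ * ⟪G i, f⟫‖) ∧
      HasSum (fun i => ⟪v, G i⟫ * ⟪G i, f⟫) ⟪v, f⟫ := by
  constructor
  · refine Summable.of_nonneg_of_le (fun _ => norm_nonneg _) (fun i => ?_)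
      ((hG v).summable.add (hG f).summable)
    rw [norm_mul, norm_inner_symm]
    nlinarith [sq_nonneg (‖⟪G i, v⟫‖ - ‖⟪G i, f⟫‖), sq_nonneg ‖⟪G i, v⟫‖, sq_nonneg ‖⟪G i, f⟫‖]
  · have hC : ∀ w : E, HasSum (fun i => (‖⟪G i, w⟫‖ : ℂ) ^ 2) ((‖w‖ : ℂ) ^ 2) := fun w => by
      exact_mod_cast (Complex.hasSum_ofReal (f := fun i => ‖⟪G i, w⟫‖ ^ 2)).2 (hG w)
    have hpol := ((((hC (v + f)).sub (hC (v - f))).add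
      (((hC (v - Complex.I • f)).sub (hC (v + Complex.I • f))).mul_right Complex.I)).div_const 4)
    rw [inner_eq_sum_norm_sq_div_four v f]
    refine hpol.congr_fun fun i => ?_
    have hi := inner_eq_sum_norm_sq_div_four (𝕜 := ℂ) ⟪G i, v⟫ ⟪G i, f⟫
    rw [RCLike.inner_apply, inner_conj_symm, mul_comm] at hi
    rw [hi]
    simp only [inner_add_right, inner_sub_right, inner_smul_right, smul_eq_mul, RCLike.I_to_complex]
    rfl

/-- The integrand of the Gabor coefficients in the cell `γ`, recentred at the origin. -/
def gaborCell {d : ℕ} (A : (Fin d → ℝ) → (Fin d → ℝ)) (g : (Fin d → ℝ) → ℝ) (γ : Fin d → ℤ)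
    (f : (Fin d → ℝ) → ℂ) (y : Fin d → ℝ) : ℂ :=
  f (y + zToR γ) * conj (magPhase A (y + zToR γ) (zToR γ)) * (g y : ℂ)

theorem norm_gaborCell_sq {d : ℕ} (A : (Fin d → ℝ) → (Fin d → ℝ)) (g : (Fin d → ℝ) → ℝ)
    (γ : Fin d → ℤ) (f : (Fin d → ℝ) → ℂ) (y : Fin d → ℝ) :
    ‖gaborCell A g γ f y‖ ^ 2 = g y ^ 2 * ‖f (y + zToR γ)‖ ^ 2 := by
  simp [gaborCell, norm_magPhase, mul_pow, mul_comm]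

theorem memLp_gaborCell {d : ℕ} {A : (Fin d → ℝ) → (Fin d → ℝ)} (hA : Continuous A)
    {g : (Fin d → ℝ) → ℝ} (hg : IsQuadPartition g) (γ : Fin d → ℤ) {f : (Fin d → ℝ) → ℂ}
    (hf : MemLp f 2 volume) : MemLp (gaborCell A g γ f) 2 volume := by
  have hfγ : MemLp (fun y => f (y + zToR γ)) 2 volume :=
    hf.comp_measurePreserving (measurePreserving_add_right volume (zToR γ))
  have hgc : Continuous g := hg.1.continuous
  have hm : Continuous fun y => magPhase A (y + zToR γ) (zToR γ) :=
    (continuous_magPhase_left hA _).comp (by fun_prop)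
  refine hfγ.of_le ((hfγ.1.mul (Complex.continuous_conj.comp hm).aestronglyMeasurable).mul
    (Complex.continuous_ofReal.comp hgc).aestronglyMeasurable)
    (Filter.Eventually.of_forall fun y => ?_)
  rw [← sq_le_sq₀ (norm_nonneg _) (norm_nonneg _), norm_gaborCell_sq]
  obtain ⟨h0, h1⟩ := hg.2.1 y
  exact mul_le_of_le_one_left (sq_nonneg _) (pow_le_one₀ h0 h1)

theorem inner_gabor_eq_integral {d : ℕ} {A : (Fin d → ℝ) → (Fin d → ℝ)} {g : (Fin d → ℝ) → ℝ}
    {γ k : Fin d → ℤ} {u : Lp ℂ 2 (volume : Measure (Fin d → ℝ))}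
    (hu : (u : (Fin d → ℝ) → ℂ) =ᵐ[volume] gaborF A g γ k)
    (f : Lp ℂ 2 (volume : Measure (Fin d → ℝ))) :
    ⟪u, f⟫ = ∫ y, (((2 * Real.pi) ^ (-(d : ℝ) / 2) : ℝ) : ℂ) *
      Complex.exp (-Complex.I * (dotR (dualV k) y / (2 * Real.pi) : ℝ)) *
        gaborCell A g γ f y := by
  rw [L2.inner_def, integral_congr_ae (g := fun x => f x * conj (gaborF A g γ k x))
    (hu.mono fun x hx => by simp only [hx, RCLike.inner_apply]),
    ← integral_add_right_eq_self _ (zToR γ)]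
  refine integral_congr_ae (Filter.Eventually.of_forall fun y => ?_)
  simp only [gaborF, gaborCell, add_sub_cancel_right, map_mul, Complex.conj_ofReal,
    ← Complex.exp_conj, Complex.conj_I]
  ring

/-- Quadratic Parseval identity for the magnetic Gabor frame. -/
theorem hasSum_norm_inner_gabor_sq {d : ℕ} {A : (Fin d → ℝ) → (Fin d → ℝ)} (hA : Continuous A)
    {g : (Fin d → ℝ) → ℝ} (hg : IsQuadPartition g)
    {G : ((Fin d → ℤ) × (Fin d → ℤ)) → Lp ℂ 2 (volume : Measure (Fin d → ℝ))}
    (hG : ∀ γ k : Fin d → ℤ, (G (γ, k) : (Fin d → ℝ) → ℂ) =ᵐ[volume] gaborF A g γ k)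
    (f : Lp ℂ 2 (volume : Measure (Fin d → ℝ))) :
    HasSum (fun aa => ‖⟪G aa, f⟫‖ ^ 2) (‖f‖ ^ 2) := by
  have hfL : MemLp f 2 volume := Lp.memLp f
  have hfint : Integrable (fun x => ‖f x‖ ^ 2) volume :=
    (memLp_two_iff_integrable_sq_norm hfL.1).1 hfL
  have hgc : Continuous g := hg.1.continuous
  have hcell : ∀ γ : Fin d → ℤ, HasSum (fun k => ‖⟪G (γ, k), f⟫‖ ^ 2)
      (∫ x, g (x - zToR γ) ^ 2 * ‖f x‖ ^ 2) := by
    intro γ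
    have h := hasSum_sq_integral_exp_of_support _ (memLp_gaborCell hA hg γ hfL) fun y hy i =>
      hg.2.2.1 (subset_tsupport g fun hg0 => hy (by simp [gaborCell, hg0])) i trivial
    simp only [norm_gaborCell_sq] at h
    rw [← integral_add_right_eq_self _ (zToR γ)]
    simpa only [inner_gabor_eq_integral (hG γ _), add_sub_cancel_right] using h
  have hpart : ∀ x, HasSum (fun γ => g (x - zToR γ) ^ 2 * ‖f x‖ ^ 2) (‖f x‖ ^ 2) := fun x => by
    simpa using (hg.2.2.2 x).mul_right (‖f x‖ ^ 2)
  have hnorm : ‖f‖ ^ 2 = ∫ x, ‖f x‖ ^ 2 := by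
    rw [← inner_self_eq_norm_sq (𝕜 := ℂ), L2.inner_def,
      ← integral_re (L2.integrable_inner f f)]
    simp only [inner_self_eq_norm_sq]
  refine hasSum_prod_of_nonneg (fun _ => sq_nonneg _) hcell ?_
  rw [hnorm]
  refine hasSum_integral_of_dominated_convergence
    (fun γ x => g (x - zToR γ) ^ 2 * ‖f x‖ ^ 2) (fun γ => ?_) (fun γ => ?_) ?_ ?_ ?_
  · exact (Continuous.aestronglyMeasurable (by fun_prop)).mul hfint.1
  · exact Filter.Eventually.of_forall fun x => (Real.norm_of_nonneg (by positivity)).le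
  · exact Filter.Eventually.of_forall fun x => (hpart x).summable
  · simpa only [fun x => (hpart x).tsum_eq] using hfint
  · exact Filter.Eventually.of_forall hpart

/-- **Bilinear Parseval identity** (equation (F-PF) in the proof of Proposition 2.2): for
all `v, f ∈ L²(ℝ^d)`, the family `((v, G^A_{aa}) (G^A_{aa}, f))_{aa ∈ Γ̃}` is absolutely
summable with sum `(v, f)_{L²}`. The frame is indexed by `(γ, k) ∈ ℤ^d × ℤ^d`, with
dual-lattice point `γ* = 2πk`, and `G` is the family of `L²`-classes of the frame
functions `gaborF A g γ k`. -/
theorem gabor_bilinear_parseval (d : ℕ) (hd : 1 ≤ d)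
    (A : (Fin d → ℝ) → (Fin d → ℝ)) (hA : Function.HasTemperateGrowth A)
    (g : (Fin d → ℝ) → ℝ) (hg : IsQuadPartition g)
    (G : ((Fin d → ℤ) × (Fin d → ℤ)) → Lp ℂ 2 (volume : Measure (Fin d → ℝ)))
    (hG : ∀ γ k : Fin d → ℤ, (G (γ, k) : (Fin d → ℝ) → ℂ) =ᵐ[volume] gaborF A g γ k)
    (v f : Lp ℂ 2 (volume : Measure (Fin d → ℝ))) :
    Summable (fun aa : (Fin d → ℤ) × (Fin d → ℤ) => ‖(⟪v, G aa⟫ : ℂ) * (⟪G aa, f⟫ : ℂ)‖) ∧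
    HasSum (fun aa : (Fin d → ℤ) × (Fin d → ℤ) => (⟪v, G aa⟫ : ℂ) * (⟪G aa, f⟫ : ℂ))
      (⟪v, f⟫ : ℂ) := by
  exact hasSum_inner_mul_inner_of_hasSum_norm_sq
    (hasSum_norm_inner_gabor_sq hA.1.continuous hg hG) v f
end
end

section
/- (Frame reconstruction, Proposition 2.2(ii).) For every f ∈ L²(ℝ^d), the family ((G^A_{α̃}, f)_{L²} · G^A_{α̃})_{α̃∈Γ̃} is summable in the norm of L²(ℝ^d) and its sum equals f, i.e. f = ∑_{α̃∈Γ̃} (G^A_{α̃}, f)_{L²} G^A_{α̃} with convergence in L²-norm. -/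
open MeasureTheory Complex
open scoped BigOperators ComplexConjugate ComplexInnerProductSpace

noncomputable section

/-- A family satisfying the Parseval identity in a Hilbert space reconstructs every vector. -/
theorem hasSum_inner_smul_of_parseval {ι E : Type*} [NormedAddCommGroup E]
    [InnerProductSpace ℂ E] [CompleteSpace E] (v : ι → E)
    (hv : ∀ f : E, HasSum (fun i => ‖(inner ℂ (v i) f : ℂ)‖ ^ 2) (‖f‖ ^ 2)) (f : E) :
    HasSum (fun i => (inner ℂ (v i) f : ℂ) • v i) f := by
  classical
  have hmem : ∀ f : E, Memℓp (fun i => (inner ℂ (v i) f : ℂ)) 2 := fun f =>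
    memℓp_gen (by simpa using (hv f).summable)
  let T₀ : E →ₗ[ℂ] lp (fun _ : ι => ℂ) 2 :=
    { toFun := fun f => ⟨fun i => inner ℂ (v i) f, hmem f⟩
      map_add' := fun x y => by ext i; exact inner_add_right _ _ _
      map_smul' := fun c x => by ext i; exact inner_smul_right _ _ _ }
  have hnorm : ∀ f, ‖T₀ f‖ = ‖f‖ := fun f => by
    have h1 := lp.hasSum_norm (p := 2) (by simp) (T₀ f)
    have h2 : ‖T₀ f‖ ^ 2 = ‖f‖ ^ 2 := by
      refine HasSum.unique (f := fun i => ‖(inner ℂ (v i) f : ℂ)‖ ^ 2) ?_ (hv f)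
      simpa [T₀] using h1
    exact (sq_eq_sq₀ (norm_nonneg _) (norm_nonneg _)).1 h2
  let T : E →L[ℂ] lp (fun _ : ι => ℂ) 2 :=
    (LinearIsometry.mk T₀ hnorm).toContinuousLinearMap
  have hT : ∀ f i, T f i = inner ℂ (v i) f := fun _ _ => rfl
  have hadj : ContinuousLinearMap.adjoint T (T f) = f :=
    DFunLike.congr_fun ((T.norm_map_iff_adjoint_comp_self).1 hnorm) f
  have hsingle : ∀ i (c : ℂ), ContinuousLinearMap.adjoint T (lp.single 2 i c) = c • v i := by
    intro i c
    refine ext_inner_right ℂ fun w => ?_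
    rw [ContinuousLinearMap.adjoint_inner_left, lp.inner_single_left, hT, inner_smul_left]
    simp [mul_comm]
  have h := (lp.hasSum_single (p := 2) (by simp) (T f)).mapL (ContinuousLinearMap.adjoint T)
  rw [hadj] at h
  simpa only [hsingle, hT] using h

section Torus

/-- The circle `ℝ / ℤ` with its normalised Haar measure. -/
local instance : MeasureSpace UnitAddCircle := ⟨AddCircle.haarAddCircle⟩

/-- **Parseval's identity** for functions on `ℝ^d` vanishing outside the unit cube. -/
theorem hasSum_sq_fourier_unit_cube {d : ℕ} {H : (Fin d → ℝ) → ℂ} (hH : MemLp H 2 volume)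
    (hsupp : ∀ y, (¬ ∀ i, y i ∈ Set.Ioc (-(1 / 2) : ℝ) (-(1 / 2) + 1)) → H y = 0) :
    HasSum (fun k : Fin d → ℤ =>
      ‖∫ y, cexp (-(2 * Real.pi * I * ∑ i, (k i : ℂ) * (y i : ℂ))) * H y‖ ^ 2)
      (∫ y, ‖H y‖ ^ 2) := by
  let a : Fin d → ℝ := fun _ => -(1 / 2)
  let S : Set (Fin d → ℝ) := {x | ∀ i, x i ∈ Set.Ioc (a i) (a i + 1)}
  have hS : MeasurableSet S := MeasurableSet.univ_pi' fun i => measurableSet_Ioc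
  let s : UnitAddTorus (Fin d) → (Fin d → ℝ) :=
    fun t => (UnitAddTorus.measurableEquivPiIoc a t : Fin d → ℝ)
  have hs : MeasurePreserving s volume (volume.restrict S) := by
    have h1 : MeasurePreserving (Subtype.val : S → (Fin d → ℝ))
        (Measure.comap Subtype.val volume) (volume.restrict S) :=
      ⟨measurable_subtype_coe, map_comap_subtype_coe hS volume⟩
    exact h1.comp (UnitAddTorus.measurePreserving_equivPiIoc a)
  have hsmk : ∀ x ∈ S, s (fun i => (x i : UnitAddCircle)) = x := by
    intro x hx
    have := (UnitAddTorus.measurableEquivPiIoc a).apply_symm_apply ⟨x, hx⟩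
    exact congrArg Subtype.val this
  have hF : MemLp (H ∘ s) 2 volume := (hH.restrict S).comp_measurePreserving hs
  have key := UnitAddTorus.hasSum_sq_mFourierCoeff (hF.toLp _)
  have hz : ∀ y, y ∉ S → H y = 0 := fun y hy => hsupp y hy
  convert key using 1
  · funext k
    congr 2
    have h1 : UnitAddTorus.mFourierCoeff (hF.toLp _) k = UnitAddTorus.mFourierCoeff (H ∘ s) k :=
      integral_congr_ae (by filter_upwards [MemLp.coeFn_toLp hF] with t ht; rw [ht])
    rw [h1, UnitAddTorus.mFourierCoeff_eq_integral _ _ a,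
      ← setIntegral_eq_integral_of_forall_compl_eq_zero (s := S)
        (fun y hy => by rw [hz y hy, mul_zero])]
    refine setIntegral_congr_fun hS fun y hy => ?_
    simp only [Function.comp, hsmk y hy, smul_eq_mul]
    congr 1
    simp only [UnitAddTorus.mFourier, ContinuousMap.coe_mk, fourier_coe_apply, ← Complex.exp_sum]
    congr 1
    rw [Finset.mul_sum, ← Finset.sum_neg_distrib]
    refine Finset.sum_congr rfl fun i _ => ?_
    simp
    ring
  · have h1 : ∫ t, ‖hF.toLp _ t‖ ^ 2 = ∫ t, ‖H (s t)‖ ^ 2 :=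
      integral_congr_ae (by filter_upwards [MemLp.coeFn_toLp hF] with t ht; rw [ht]; rfl)
    rw [h1, UnitAddTorus.integral_preimage _ a,
      ← setIntegral_eq_integral_of_forall_compl_eq_zero (s := S)
        (fun y hy => by rw [hz y hy]; simp)]
    refine setIntegral_congr_fun hS fun y hy => ?_
    simp only [hsmk y hy]

end Torus

/-- **Parseval's identity** for functions on `ℝ^d` supported in a cube of side `2` around `c`,
with respect to the exponentials of period `2π`. -/
theorem hasSum_sq_fourier_cube {d : ℕ} {ψ : (Fin d → ℝ) → ℂ} (hψ : MemLp ψ 2 volume)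
    (c : Fin d → ℝ)
    (hsupp : ∀ x, (¬ ∀ i, (x - c) i ∈ Set.Ioo (-1 : ℝ) 1) → ψ x = 0) :
    HasSum (fun k : Fin d → ℤ =>
      ‖∫ x, cexp (-(I * ∑ i, (k i : ℂ) * ((x - c) i : ℂ))) * ψ x‖ ^ 2)
      ((2 * Real.pi) ^ d * ∫ x, ‖ψ x‖ ^ 2) := by
  have hπ : (0 : ℝ) < 2 * Real.pi := by positivity
  have hsub : ∀ {E : Type} [NormedAddCommGroup E] [NormedSpace ℝ E] (F : (Fin d → ℝ) → E),
      ∫ y : Fin d → ℝ, F ((2 * Real.pi) • y + c) = ((2 * Real.pi) ^ d)⁻¹ • ∫ x, F x := by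
    intro E _ _ F
    rw [Measure.integral_comp_smul volume (fun x => F (x + c)) (2 * Real.pi),
      integral_add_right_eq_self]
    simp [abs_of_pos hπ]
  have hmem : MemLp (fun y => ψ ((2 * Real.pi) • y + c)) 2 volume := by
    have h1 : MemLp (fun x => ψ (x + c)) 2 volume :=
      hψ.comp_measurePreserving (measurePreserving_add_right volume c)
    have h2 : MemLp (fun x => ψ (x + c)) 2
        (Measure.map (fun y : Fin d → ℝ => (2 * Real.pi) • y) volume) := by
      rw [Measure.map_addHaar_smul volume hπ.ne']
      exact h1.smul_measure ENNReal.ofReal_ne_top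
    exact h2.comp_of_map (measurable_const_smul _).aemeasurable
  have key := hasSum_sq_fourier_unit_cube hmem ?_
  · rw [hsub fun x => ‖ψ x‖ ^ 2] at key
    have key2 := key.mul_left (((2 * Real.pi) ^ d) ^ 2)
    convert! key2 using 1
    · funext k
      have h3 := hsub fun x => cexp (-(I * ∑ i, (k i : ℂ) * ((x - c) i : ℂ))) * ψ x
      have h4 : ∀ y : Fin d → ℝ, -(I * ∑ i, (k i : ℂ) * ((((2 * Real.pi) • y + c) - c) i : ℂ))
          = -(2 * Real.pi * I * ∑ i, (k i : ℂ) * (y i : ℂ)) := by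
        intro y
        rw [Finset.mul_sum, Finset.mul_sum]
        congr 1
        refine Finset.sum_congr rfl fun i _ => ?_
        simp
        ring
      simp only [h4] at h3
      rw [h3, norm_smul, Real.norm_of_nonneg (by positivity)]
      field_simp
    · rw [smul_eq_mul, ← mul_assoc, sq, mul_assoc _ _ (_⁻¹), mul_inv_cancel₀ (by positivity),
        mul_one]
  · intro y hy
    refine hsupp _ fun h => hy fun i => ?_
    have h1 := h i
    simp only [add_sub_cancel_right, Pi.smul_apply, smul_eq_mul, Set.mem_Ioo] at h1
    have := Real.pi_gt_three
    constructor <;> nlinarith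

theorem gaborF_eq_exp_mul {d : ℕ} (A : (Fin d → ℝ) → (Fin d → ℝ)) (g : (Fin d → ℝ) → ℝ)
    (γ k : Fin d → ℤ) (x : Fin d → ℝ) :
    gaborF A g γ k x =
      cexp (I * ∑ i, (k i : ℂ) * ((x - zToR γ) i : ℂ)) * gaborF A g γ 0 x := by
  have h : ∀ m : Fin d → ℤ, ((dotR (dualV m) (x - zToR γ) / (2 * Real.pi) : ℝ) : ℂ) =
      ∑ i, (m i : ℂ) * ((x - zToR γ) i : ℂ) := by
    intro m
    rw [dotR, Finset.sum_div, Complex.ofReal_sum]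
    refine Finset.sum_congr rfl fun i _ => ?_
    have : (2 * Real.pi) ≠ 0 := by positivity
    rw [dualV, mul_assoc, mul_div_cancel_left₀ _ this]
    push_cast
    rfl
  simp only [gaborF, h]
  simp
  ring

theorem norm_gaborF_zero_sq {d : ℕ} (A : (Fin d → ℝ) → (Fin d → ℝ)) (g : (Fin d → ℝ) → ℝ)
    (γ : Fin d → ℤ) (x : Fin d → ℝ) :
    ‖gaborF A g γ 0 x‖ ^ 2 = ((2 * Real.pi) ^ d)⁻¹ * g (x - zToR γ) ^ 2 := by
  have h1 : ‖magPhase A x (zToR γ)‖ = 1 := by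
    simp [magPhase, Complex.norm_exp]
  have h2 : dotR (dualV (0 : Fin d → ℤ)) (x - zToR γ) = 0 := by simp [dotR, dualV]
  have h3 : ((2 * Real.pi) ^ (-(d : ℝ) / 2)) ^ 2 = ((2 * Real.pi) ^ d)⁻¹ := by
    rw [← Real.rpow_natCast, ← Real.rpow_mul (by positivity), ← Real.rpow_natCast,
      ← Real.rpow_neg (by positivity)]
    congr 1
    push_cast
    ring
  rw [gaborF, norm_mul, norm_mul, norm_mul, h1, h2, Complex.norm_real, Complex.norm_real]
  simp [mul_pow, h3]

/-- The frame functions based at a single lattice point `γ` satisfy a localised Parseval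
identity. -/
theorem hasSum_sq_inner_gaborF {d : ℕ} {A : (Fin d → ℝ) → (Fin d → ℝ)}
    {g : (Fin d → ℝ) → ℝ} (hg : IsQuadPartition g) (γ : Fin d → ℤ)
    (G : (Fin d → ℤ) → Lp ℂ 2 (volume : Measure (Fin d → ℝ)))
    (hG : ∀ k, (G k : (Fin d → ℝ) → ℂ) =ᵐ[volume] gaborF A g γ k)
    (f : Lp ℂ 2 (volume : Measure (Fin d → ℝ))) :
    HasSum (fun k => ‖(inner ℂ (G k) f : ℂ)‖ ^ 2)
      (∫ x, g (x - zToR γ) ^ 2 * ‖f x‖ ^ 2) := by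
  obtain ⟨-, hg01, hgs, -⟩ := hg
  have hπ : (0 : ℝ) < (2 * Real.pi) ^ d := by positivity
  have hmeas : AEStronglyMeasurable (gaborF A g γ 0) volume :=
    (Lp.aestronglyMeasurable (G 0)).congr (hG 0)
  let ψ : (Fin d → ℝ) → ℂ := fun x => conj (gaborF A g γ 0 x) * f x
  have hψsq : ∀ x, ‖ψ x‖ ^ 2 = ((2 * Real.pi) ^ d)⁻¹ * (g (x - zToR γ) ^ 2 * ‖f x‖ ^ 2) := by
    intro x
    rw [norm_mul, mul_pow, RCLike.norm_conj, norm_gaborF_zero_sq, mul_assoc]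
  have hψ : MemLp ψ 2 volume := by
    refine (Lp.memLp f).of_le_mul (c := Real.sqrt ((2 * Real.pi) ^ d)⁻¹)
      ((Complex.continuous_conj.comp_aestronglyMeasurable hmeas).mul
        (Lp.aestronglyMeasurable f)) (Filter.Eventually.of_forall fun x => ?_)
    rw [norm_mul, RCLike.norm_conj]
    refine mul_le_mul_of_nonneg_right (Real.le_sqrt_of_sq_le ?_) (norm_nonneg _)
    rw [norm_gaborF_zero_sq]
    obtain ⟨h0, h1⟩ := hg01 (x - zToR γ)
    exact mul_le_of_le_one_right (by positivity) (pow_le_one₀ h0 h1)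
  have hsupp : ∀ x, (¬ ∀ i, (x - zToR γ) i ∈ Set.Ioo (-1 : ℝ) 1) → ψ x = 0 := by
    intro x hx
    have : g (x - zToR γ) = 0 := by
      by_contra h
      exact hx fun i => hgs (subset_tsupport g h) i (Set.mem_univ i)
    simp [ψ, gaborF, this]
  have key := hasSum_sq_fourier_cube hψ (zToR γ) hsupp
  convert! key using 1
  · funext k
    rw [L2.inner_def]
    congr 2
    refine integral_congr_ae ?_
    filter_upwards [hG k] with x hx
    rw [hx, gaborF_eq_exp_mul, RCLike.inner_apply, map_mul, ← Complex.exp_conj, map_mul,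
      Complex.conj_I, map_sum]
    simp [ψ]
    ring
  · simp only [hψsq]
    rw [integral_const_mul, mul_inv_cancel_left₀ hπ.ne']

/-- Translates of a quadratic partition of unity decompose the square of the `L²` norm. -/
theorem IsQuadPartition.hasSum_integral {d : ℕ} {g : (Fin d → ℝ) → ℝ} (hg : IsQuadPartition g)
    (f : Lp ℂ 2 (volume : Measure (Fin d → ℝ))) :
    HasSum (fun γ => ∫ x, g (x - zToR γ) ^ 2 * ‖f x‖ ^ 2) (‖f‖ ^ 2) := by
  obtain ⟨hgc, -, -, hg1⟩ := hg
  have hfi : Integrable (fun x => ‖f x‖ ^ 2) volume := (Lp.memLp f).integrable_norm_pow two_ne_zero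
  have hnorm : ‖f‖ ^ 2 = ∫ x, ‖f x‖ ^ 2 := by
    have h := @inner_self_eq_norm_sq ℂ _ _ _ _ f
    rw [L2.inner_def, ← integral_re (L2.integrable_inner f f)] at h
    simpa only [inner_self_eq_norm_sq] using h.symm
  have hs : ∀ x, HasSum (fun γ => g (x - zToR γ) ^ 2 * ‖f x‖ ^ 2) (‖f x‖ ^ 2) := fun x => by
    simpa using (hg1 x).mul_right (‖f x‖ ^ 2)
  rw [hnorm]
  refine hasSum_integral_of_dominated_convergence
    (fun γ x => g (x - zToR γ) ^ 2 * ‖f x‖ ^ 2) (fun γ => ?_)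
    (fun γ => Filter.Eventually.of_forall fun x => ?_)
    (Filter.Eventually.of_forall fun x => (hs x).summable) ?_
    (Filter.Eventually.of_forall hs)
  · have : Continuous fun x => g (x - zToR γ) ^ 2 :=
      (hgc.continuous.comp (continuous_id.sub continuous_const)).pow 2
    exact this.aestronglyMeasurable.mul hfi.aestronglyMeasurable
  · rw [Real.norm_of_nonneg (by positivity)]
  · simpa only [(hs _).tsum_eq] using hfi

/-- **Frame reconstruction** (Proposition 2.2(ii)): for every `f ∈ L²(ℝ^d)`, the family
`((G^A_{aa}, f)_{L²} · G^A_{aa})_{aa ∈ Γ̃}` is summable in the norm of `L²(ℝ^d)`, with sum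
`f`. The frame is indexed by `(γ, k) ∈ ℤ^d × ℤ^d`, with dual-lattice point `γ* = 2πk`, and
`G` is the family of `L²`-classes of the frame functions `gaborF A g γ k`. -/
theorem gabor_frame_reconstruction (d : ℕ) (hd : 1 ≤ d)
    (A : (Fin d → ℝ) → (Fin d → ℝ)) (hA : Function.HasTemperateGrowth A)
    (g : (Fin d → ℝ) → ℝ) (hg : IsQuadPartition g)
    (G : ((Fin d → ℤ) × (Fin d → ℤ)) → Lp ℂ 2 (volume : Measure (Fin d → ℝ)))
    (hG : ∀ γ k : Fin d → ℤ, (G (γ, k) : (Fin d → ℝ) → ℂ) =ᵐ[volume] gaborF A g γ k)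
    (f : Lp ℂ 2 (volume : Measure (Fin d → ℝ))) :
    HasSum (fun aa : (Fin d → ℤ) × (Fin d → ℤ) => (⟪G aa, f⟫ : ℂ) • G aa) f := by
  refine hasSum_inner_smul_of_parseval G (fun f => ?_) f
  have h1 : ∀ γ, HasSum (fun k => ‖(inner ℂ (G (γ, k)) f : ℂ)‖ ^ 2)
      (∫ x, g (x - zToR γ) ^ 2 * ‖f x‖ ^ 2) := fun γ =>
    hasSum_sq_inner_gaborF hg γ (fun k => G (γ, k)) (hG γ) f
  have h2 := hg.hasSum_integral f
  have hsum : Summable fun aa : (Fin d → ℤ) × (Fin d → ℤ) => ‖(inner ℂ (G aa) f : ℂ)‖ ^ 2 := by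
    refine (summable_prod_of_nonneg fun _ => by positivity).2 ⟨fun γ => (h1 γ).summable, ?_⟩
    simpa only [(h1 _).tsum_eq] using h2.summable
  have h3 := hsum.hasSum.prod_fiberwise h1
  rw [h2.unique h3]
  exact hsum.hasSum
end
end
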